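/- For every measurable set M ⊆ Σ, the quotient measure of the projected set equals the measure of the original set: μ̂(M̂) = μ(M). -/

import Mathlib

open MeasureTheory Filter Real

namespace ZipShiftPaper

variable {Sm Sp : Type*}

/-- `s` is an admissible symbol for index `i`: a negative symbol (inl) if `i < 0`,
a positive symbol (inr) if `i ≥ 0`. -/
def Adm (i : ℤ) (s : Sm ⊕ Sp) : Prop :=
  if i < 0 then s.isLeft = true else s.isRight = true

/-- The zip shift space: bilateral sequences with positive symbols on indices `≥ 0`
and negative symbols on indices `< 0`. -/
def ZipSpace (Sm Sp : Type*) := {x : ℤ → Sm ⊕ Sp // ∀ i, Adm i (x i)}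

variable (φ : Sp → Sm)

/-- The transition function applied to a combined symbol. -/
def phiHat : Sm ⊕ Sp → Sm ⊕ Sp
  | .inl t => .inl t
  | .inr s => .inl (φ s)

lemma adm_shift (x : ZipSpace Sm Sp) (i : ℤ) :
    Adm i (if i = -1 then phiHat φ (x.1 0) else x.1 (i + 1)) := by
  by_cases h : i = -1
  · subst h
    have h0 := x.2 0
    simp only [Adm, if_neg (by norm_num : ¬ (0:ℤ) < 0)] at h0
    simp only [if_pos rfl, Adm, if_pos (by norm_num : (-1:ℤ) < 0)]
    rcases hx : x.1 0 with t | s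
    · rw [hx] at h0; simp at h0
    · simp [phiHat]
  · rw [if_neg h]
    have h1 := x.2 (i + 1)
    unfold Adm at h1 ⊢
    by_cases hi : i < 0
    · rw [if_pos hi]; rw [if_pos (by omega)] at h1; exact h1
    · rw [if_neg hi]; rw [if_neg (by omega)] at h1; exact h1

/-- The zip shift map `σ_φ`. -/
def zipShift (x : ZipSpace Sm Sp) : ZipSpace Sm Sp :=
  ⟨fun i => if i = -1 then phiHat φ (x.1 0) else x.1 (i + 1), adm_shift φ x⟩

/-- The cylinder `C^s_i = {x : x_i = s}`. -/
def cyl (i : ℤ) (s : Sm ⊕ Sp) : Set (ZipSpace Sm Sp) := {x | x.1 i = s}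

/-- The σ-algebra on the zip shift space, generated by the cylinders. -/
instance zipMS : MeasurableSpace (ZipSpace Sm Sp) :=
  .generateFrom {C | ∃ i s, C = cyl i s}

/-- The partition `𝒞_i` of `Σ` by cylinders of index `i`. -/
def cylPart (i : ℤ) : Set (Set (ZipSpace Sm Sp)) :=
  {C | ∃ s : Sm ⊕ Sp, Adm i s ∧ C = cyl i s}

/-- Forward image of a partition: `f(P) = {f(A) : A ∈ P}`. -/
def pushPart {α : Type*} (f : α → α) (P : Set (Set α)) : Set (Set α) :=
  (Set.image f) '' P

/-- Pullback of a partition: `f⁻¹(P) = {f⁻¹(A) : A ∈ P}`. -/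
def pullPart {α : Type*} (f : α → α) (P : Set (Set α)) : Set (Set α) :=
  (Set.preimage f) '' P

/-- `σ^j(P)` for `j : ℤ`: forward image for `j ≥ 0`, preimage for `j < 0`. -/
def powPart {α : Type*} (f : α → α) (j : ℤ) (P : Set (Set α)) : Set (Set α) :=
  if 0 ≤ j then pushPart (f^[j.toNat]) P else pullPart (f^[(-j).toNat]) P

/-- Common refinement (correfinement) `⋁_{i ∈ t} P i` of a family of partitions:
all nonempty intersections of one element from each partition. -/
def corefine {α ι : Type*} (t : Set ι) (P : ι → Set (Set α)) : Set (Set α) :=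
  {A | A.Nonempty ∧ ∃ g : ι → Set α, (∀ i ∈ t, g i ∈ P i) ∧ A = ⋂ i ∈ t, g i}

/-- The partition `𝒞_{n,…,n'}` by cylinders of indices from `n` to `n'`. -/
def cylRange (n n' : ℤ) : Set (Set (ZipSpace Sm Sp)) :=
  corefine (Set.Icc n n') cylPart

/-- The `k`-th dynamical correfinement `⋁_{j=0}^{k-1} f^{-j}(P)`. -/
def dynRefine {α : Type*} (f : α → α) (P : Set (Set α)) (k : ℕ) : Set (Set α) :=
  corefine (Set.Iio k) (fun j : ℕ => pullPart (f^[j]) P)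

/-- Entropy of a partition: `H_μ(P) = Σ_{A ∈ P} -μ(A) log μ(A)`. -/
noncomputable def partH {α : Type*} [MeasurableSpace α] (μ : Measure α)
    (P : Set (Set α)) : ℝ :=
  ∑' A : P, Real.negMulLog ((μ (A : Set α)).toReal)

variable (pp : Sp → ℝ) [Fintype Sp] [DecidableEq Sm]

/-- The pushforward distribution `p⁻ = φ_* p⁺` on the negative symbols. -/
def pm (t : Sm) : ℝ := ∑ s ∈ Finset.univ.filter (fun s => φ s = t), pp s

/-- The weight of symbol `s` at coordinate `i`: `p⁺_s` for a positive symbol at `i ≥ 0`,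
`p⁻_s` for a negative symbol at `i < 0`, and `0` for inadmissible pairs. -/
def wt : ℤ → Sm ⊕ Sp → ℝ
  | i, .inl t => if i < 0 then pm φ pp t else 0
  | i, .inr s => if 0 ≤ i then pp s else 0

/-- `μ` is the product measure determined by `p⁺` (coordinates independent, coordinate `i`
distributed as `p⁺` for `i ≥ 0` and as `p⁻ = φ_* p⁺` for `i < 0`). -/
def IsProductMeasure (μ : Measure (ZipSpace Sm Sp)) : Prop :=
  ∀ (F : Finset ℤ) (c : ℤ → Sm ⊕ Sp),
    μ {x : ZipSpace Sm Sp | ∀ i ∈ F, x.1 i = c i}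
      = ∏ i ∈ F, ENNReal.ofReal (wt φ pp i (c i))

/-- The fiber space `σ⁻¹(ε) = {σ⁻¹({x}) : x ∈ Σ}`: the partition of `Σ` into
preimages of points, viewed as a type. -/
def Fib (φ : Sp → Sm) := {A : Set (ZipSpace Sm Sp) // ∃ x, A = zipShift φ ⁻¹' {x}}

/-- The natural projection `π : Σ → σ⁻¹(ε)`, `π(y) = σ⁻¹({σ(y)})`. -/
def fibProj (y : ZipSpace Sm Sp) : Fib φ :=
  ⟨zipShift φ ⁻¹' {zipShift φ y}, zipShift φ y, rfl⟩

/-- The quotient σ-algebra on `σ⁻¹(ε)`: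
`Q` is measurable iff `π⁻¹(Q)` is measurable in `Σ`. -/
instance fibMS : MeasurableSpace (Fib φ) :=
  MeasurableSpace.map (fibProj φ) (zipMS)

/-- `X̂ = {x̂ : x ∈ X}`, the set of fibers of points of `X`. -/
def hatSet (X : Set (ZipSpace Sm Sp)) : Set (Fib φ) :=
  {A | ∃ x ∈ X, A.1 = zipShift φ ⁻¹' {x}}

/-- The negative symbol `x_{-1}` of a point of the zip shift space. -/
def negSym (x : ZipSpace Sm Sp) : Sm :=
  (x.1 (-1)).getLeft (by
    have h := x.2 (-1)
    simpa [Adm, if_pos (by norm_num : (-1:ℤ) < 0)] using h)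

/-- The preimage `x̂(s) = (…, x_{-2}; s, x_0, x_1, …)` of `x` under the zip shift,
determined by the choice of positive symbol `s ∈ φ⁻¹(x_{-1})` at coordinate `0`. -/
def prePoint (x : ZipSpace Sm Sp) (s : Sp) : ZipSpace Sm Sp :=
  ⟨fun j => if j = 0 then .inr s else x.1 (j - 1), by
    intro j
    dsimp only
    by_cases h : j = 0
    · subst h
      simp [Adm]
    · rw [if_neg h]
      have h1 := x.2 (j - 1)
      unfold Adm at h1 ⊢
      by_cases hj : j < 0
      · rw [if_pos hj]; rw [if_pos (by omega)] at h1; exact h1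
      · rw [if_neg hj]; rw [if_neg (by omega)] at h1; exact h1⟩

/-- The conditional measure `μ_{x̂}` on the fiber `x̂ = σ⁻¹({x})`, giving mass
`q^{x_{-1}}_s = p⁺_s / p⁻_{x_{-1}}` to the point `x̂(s)`, `s ∈ φ⁻¹(x_{-1})`. -/
noncomputable def condMeas (x : ZipSpace Sm Sp) : Measure (ZipSpace Sm Sp) :=
  ∑ s ∈ Finset.univ.filter (fun s => φ s = negSym x),
    (ENNReal.ofReal (pp s / pm φ pp (negSym x))) • Measure.dirac (prePoint x s)

/-- The conditional measure attached to a fiber `A ∈ σ⁻¹(ε)`. -/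
noncomputable def condMeasFib (A : Fib φ) : Measure (ZipSpace Sm Sp) :=
  condMeas φ pp A.2.choose

/-- The entropy `H_{μ_{x̂}}(ε|_{x̂})` of the restriction of the atomic partition to the
fiber `x̂`, with respect to the conditional measure `μ_{x̂}`. -/
noncomputable def fibH (A : Fib φ) : ℝ :=
  ∑' y : A.1,
    Real.negMulLog ((condMeasFib φ pp A {(y : ZipSpace Sm Sp)}).toReal)

/-- The folding entropy `F(σ) = ∫ H_{μ_{x̂}}(ε|_{x̂}) dμ̂(x̂)`, where `μ̂ = π_* μ` is the
quotient measure on `σ⁻¹(ε)`. -/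
noncomputable def foldH (μ : Measure (ZipSpace Sm Sp)) : ℝ :=
  ∫ A, fibH φ pp A ∂(μ.map (fibProj φ))

/-- A finite measurable partition (mod 0) of a probability space. -/
def IsFinPart {α : Type*} [MeasurableSpace α] (μ : Measure α) (P : Set (Set α)) : Prop :=
  P.Finite ∧ (∀ A ∈ P, MeasurableSet A) ∧ P.Pairwise Disjoint ∧ μ (⋃₀ P) = 1


/-- The Kolmogorov–Sinai entropy: the supremum, over all finite measurable partitions `P`,
of the limits `h_μ(f, P) = lim_n H_μ(⋁_{j=0}^{n-1} f^{-j}P)/n`. -/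
noncomputable def ksEntropy {α : Type*} [MeasurableSpace α] (μ : Measure α) (f : α → α) : ℝ :=
  sSup {h : ℝ | ∃ P : Set (Set α), IsFinPart μ P ∧
    Tendsto (fun n : ℕ => partH μ (dynRefine f P n) / n) atTop (nhds h)}


end ZipShiftPaper

open ZipShiftPaper


namespace ZipShiftPaper

lemma measurableSet_cyl {Sm Sp : Type*} (i : ℤ) (s : Sm ⊕ Sp) :
    MeasurableSet (cyl i s : Set (ZipSpace Sm Sp)) :=
  MeasurableSpace.measurableSet_generateFrom ⟨i, s, rfl⟩

/-- The cylinder with prescribed symbols `c i` at the finitely many indices `i ∈ F`. -/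
def finCyl {Sm Sp : Type*} (F : Finset ℤ) (c : ℤ → Sm ⊕ Sp) : Set (ZipSpace Sm Sp) :=
  {x | ∀ i ∈ F, x.1 i = c i}

lemma measurableSet_finCyl {Sm Sp : Type*} (F : Finset ℤ) (c : ℤ → Sm ⊕ Sp) :
    MeasurableSet (finCyl F c) := by
  have h : finCyl F c = ⋂ i ∈ F, cyl i (c i) := by
    ext x
    simp [finCyl, cyl]
  rw [h]
  exact F.measurableSet_biInter fun i _ => measurableSet_cyl i (c i)

lemma isPiSystem_finCyl {Sm Sp : Type*} :
    IsPiSystem {A : Set (ZipSpace Sm Sp) | ∃ F c, A = finCyl F c} := by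
  rintro _ ⟨F, c, rfl⟩ _ ⟨G, d, rfl⟩ ⟨x, hxF, hxG⟩
  refine ⟨F ∪ G, x.1, ?_⟩
  ext y
  constructor
  · rintro ⟨hyF, hyG⟩ i hi
    rcases Finset.mem_union.1 hi with h | h
    · rw [hyF i h, hxF i h]
    · rw [hyG i h, hxG i h]
  · intro hy
    exact ⟨fun i hi => (hy i (Finset.mem_union_left _ hi)).trans (hxF i hi),
      fun i hi => (hy i (Finset.mem_union_right _ hi)).trans (hxG i hi)⟩

lemma zipMS_eq_generateFrom_finCyl {Sm Sp : Type*} :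
    (zipMS : MeasurableSpace (ZipSpace Sm Sp)) =
      .generateFrom {A | ∃ F c, A = finCyl F c} := by
  apply le_antisymm
  · refine MeasurableSpace.generateFrom_mono ?_
    rintro _ ⟨i, s, rfl⟩
    exact ⟨{i}, fun _ => s, by ext x; simp [finCyl, cyl]⟩
  · refine MeasurableSpace.generateFrom_le ?_
    rintro _ ⟨F, c, rfl⟩
    exact measurableSet_finCyl F c

lemma exists_eq_inr {Sm Sp : Type*} (x : ZipSpace Sm Sp) : ∃ s, x.1 0 = .inr s := by
  have h := x.2 0
  rw [Adm, if_neg (lt_irrefl 0)] at h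
  exact Sum.isRight_iff.1 h

lemma zipShift_apply_neg_one {Sm Sp : Type*} (φ : Sp → Sm) (x : ZipSpace Sm Sp) :
    (zipShift φ x).1 (-1) = phiHat φ (x.1 0) := by
  simp [zipShift]

lemma zipShift_apply_of_ne {Sm Sp : Type*} (φ : Sp → Sm) (x : ZipSpace Sm Sp) {i : ℤ}
    (hi : i ≠ -1) : (zipShift φ x).1 i = x.1 (i + 1) := by
  simp [zipShift, hi]

lemma measurable_zipShift {Sm Sp : Type*} [Finite Sp] (φ : Sp → Sm) :
    Measurable (zipShift φ) := by
  refine measurable_generateFrom ?_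
  rintro _ ⟨i, s, rfl⟩
  by_cases hi : i = -1
  · subst hi
    have h : zipShift φ ⁻¹' cyl (-1) s =
        ⋃ r ∈ {r : Sp | phiHat φ (.inr r) = s}, cyl 0 (.inr r) := by
      ext x
      obtain ⟨r, hr⟩ := exists_eq_inr x
      simp [cyl, zipShift_apply_neg_one, hr]
    rw [h]
    exact (Set.toFinite _).measurableSet_biUnion fun r _ => measurableSet_cyl 0 _
  · have h : zipShift φ ⁻¹' cyl i s = cyl (i + 1) s := by
      ext x
      simp [cyl, zipShift_apply_of_ne φ x hi]
    rw [h]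
    exact measurableSet_cyl _ _

lemma zipShift_surjective {Sm Sp : Type*} {φ : Sp → Sm} (hφ : Function.Surjective φ) :
    Function.Surjective (zipShift φ) := by
  intro x
  have h := x.2 (-1)
  rw [Adm, if_pos (by norm_num)] at h
  obtain ⟨t, ht⟩ := Sum.isLeft_iff.1 h
  obtain ⟨s, rfl⟩ := hφ t
  refine ⟨prePoint x s, Subtype.ext (funext fun i => ?_)⟩
  by_cases hi : i = -1
  · subst hi
    rw [zipShift_apply_neg_one, ht]
    simp [prePoint, phiHat]
  · rw [zipShift_apply_of_ne φ _ hi]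
    have hi' : i + 1 ≠ 0 := by omega
    simp [prePoint, hi']

lemma fibProj_preimage_hatSet {Sm Sp : Type*} {φ : Sp → Sm} (hφ : Function.Surjective φ)
    (M : Set (ZipSpace Sm Sp)) : fibProj φ ⁻¹' hatSet φ M = zipShift φ ⁻¹' M := by
  ext y
  constructor
  · rintro ⟨x, hx, h⟩
    have hxy := Set.preimage_injective.2 (zipShift_surjective hφ) h
    rw [Set.mem_preimage, Set.singleton_injective hxy]
    exact hx
  · exact fun hy => ⟨zipShift φ y, hy, rfl⟩

lemma wt_add_one {Sm Sp : Type*} [Fintype Sp] [DecidableEq Sm] (φ : Sp → Sm) (pp : Sp → ℝ)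
    {i : ℤ} (hi : i ≠ -1) (s : Sm ⊕ Sp) : wt φ pp (i + 1) s = wt φ pp i s := by
  rcases s with t | s
  · have h : i + 1 < 0 ↔ i < 0 := by omega
    simp only [wt, h]
  · have h : 0 ≤ i + 1 ↔ 0 ≤ i := by omega
    simp only [wt, h]

/-- The translate `F + 1` of a finite set of indices. -/
def shiftIdx (F : Finset ℤ) : Finset ℤ := F.map (addRightEmbedding 1)

lemma zipShift_preimage_finCyl {Sm Sp : Type*} (φ : Sp → Sm) {F : Finset ℤ}
    (hF : -1 ∉ F) (c : ℤ → Sm ⊕ Sp) :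
    zipShift φ ⁻¹' finCyl F c = finCyl (shiftIdx F) fun i => c (i - 1) := by
  ext x
  simp only [finCyl, shiftIdx, Set.mem_preimage, Set.mem_ofPred_eq, Finset.forall_mem_map,
    addRightEmbedding_apply, add_sub_cancel_right]
  refine forall₂_congr fun i hi => ?_
  rw [zipShift_apply_of_ne φ x (ne_of_mem_of_not_mem hi hF)]

lemma prod_shiftIdx {Sm Sp : Type*} [Fintype Sp] [DecidableEq Sm] (φ : Sp → Sm) (pp : Sp → ℝ)
    {F : Finset ℤ} (hF : -1 ∉ F) (c : ℤ → Sm ⊕ Sp) :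
    ∏ i ∈ shiftIdx F, ENNReal.ofReal (wt φ pp i (c (i - 1))) =
      ∏ i ∈ F, ENNReal.ofReal (wt φ pp i (c i)) := by
  rw [shiftIdx, Finset.prod_map]
  refine Finset.prod_congr rfl fun i hi => ?_
  simp only [addRightEmbedding_apply, add_sub_cancel_right]
  rw [wt_add_one φ pp (ne_of_mem_of_not_mem hi hF)]

lemma zipShift_preimage_finCyl_insert {Sm Sp : Type*} [Fintype Sp] [DecidableEq Sm]
    (φ : Sp → Sm) {F : Finset ℤ} (hF : -1 ∉ F) (c : ℤ → Sm ⊕ Sp) {t : Sm}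
    (ht : c (-1) = .inl t) :
    zipShift φ ⁻¹' finCyl (insert (-1) F) c =
      ⋃ s ∈ Finset.univ.filter (fun s => φ s = t),
        cyl 0 (.inr s) ∩ finCyl (shiftIdx F) fun i => c (i - 1) := by
  rw [← zipShift_preimage_finCyl φ hF]
  ext x
  obtain ⟨r, hr⟩ := exists_eq_inr x
  simp [finCyl, cyl, zipShift_apply_neg_one, hr, ht, phiHat]

lemma IsProductMeasure.measure_cyl_inter_finCyl {Sm Sp : Type*} [Fintype Sp] [DecidableEq Sm]
    {φ : Sp → Sm} {pp : Sp → ℝ} {μ : Measure (ZipSpace Sm Sp)} (hμ : IsProductMeasure φ pp μ)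
    {i : ℤ} {F : Finset ℤ} (hi : i ∉ F) (s : Sm ⊕ Sp) (c : ℤ → Sm ⊕ Sp) :
    μ (cyl i s ∩ finCyl F c) =
      ENNReal.ofReal (wt φ pp i s) * ∏ j ∈ F, ENNReal.ofReal (wt φ pp j (c j)) := by
  have hne : ∀ j ∈ F, Function.update c i s j = c j := fun j hj =>
    Function.update_of_ne (ne_of_mem_of_not_mem hj hi) _ _
  have h : cyl i s ∩ finCyl F c =
      {x | ∀ j ∈ insert i F, x.1 j = Function.update c i s j} := by
    ext x
    simp only [cyl, finCyl, Set.mem_inter_iff, Set.mem_ofPred_eq, Finset.forall_mem_insert,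
      Function.update_self]
    refine and_congr_right fun _ => forall₂_congr fun j hj => ?_
    rw [hne j hj]
  rw [h, hμ, Finset.prod_insert hi, Function.update_self]
  congr 1
  exact Finset.prod_congr rfl fun j hj => by rw [hne j hj]

lemma IsProductMeasure.measure_zipShift_preimage_finCyl {Sm Sp : Type*} [Fintype Sp]
    [DecidableEq Sm] {φ : Sp → Sm} {pp : Sp → ℝ} (hpp : ∀ s, 0 ≤ pp s)
    {μ : Measure (ZipSpace Sm Sp)} (hμ : IsProductMeasure φ pp μ)
    (F : Finset ℤ) (c : ℤ → Sm ⊕ Sp) :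
    μ (zipShift φ ⁻¹' finCyl F c) = μ (finCyl F c) := by
  by_cases hF : -1 ∈ F
  · obtain ⟨G, hG, rfl⟩ : ∃ G, -1 ∉ G ∧ insert (-1) G = F :=
      ⟨F.erase (-1), Finset.notMem_erase _ _, Finset.insert_erase hF⟩
    have h0 : 0 ∉ shiftIdx G := by
      intro h
      obtain ⟨i, hi, h⟩ := Finset.mem_map.1 h
      rw [addRightEmbedding_apply] at h
      exact hG (by rwa [show i = -1 by omega] at hi)
    have hμF : μ (finCyl (insert (-1) G) c) =
        ∏ i ∈ insert (-1) G, ENNReal.ofReal (wt φ pp i (c i)) := hμ _ _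
    rw [hμF, Finset.prod_insert hG]
    rcases hc : c (-1) with t | s
    · rw [zipShift_preimage_finCyl_insert φ hG c hc, measure_biUnion_finset]
      · simp_rw [hμ.measure_cyl_inter_finCyl h0]
        rw [prod_shiftIdx φ pp hG, ← Finset.sum_mul]
        congr 1
        simp only [wt, le_refl, if_true]
        rw [if_pos (by norm_num), pm, ENNReal.ofReal_sum_of_nonneg fun s _ => hpp s]
      · intro r _ s _ hrs
        refine Set.disjoint_left.2 fun x hr hs => hrs ?_
        exact Sum.inr_injective (hr.1.symm.trans hs.1)
      · exact fun s _ => (measurableSet_cyl _ _).inter (measurableSet_finCyl _ _)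
    · have h : zipShift φ ⁻¹' finCyl (insert (-1) G) c = ∅ := by
        refine Set.eq_empty_of_forall_notMem fun x hx => ?_
        obtain ⟨r, hr⟩ := exists_eq_inr x
        have h := hx (-1) (Finset.mem_insert_self _ _)
        rw [zipShift_apply_neg_one, hr, hc] at h
        exact Sum.inl_ne_inr h
      rw [h]
      simp [wt]
  · have hμF : μ (finCyl F c) = ∏ i ∈ F, ENNReal.ofReal (wt φ pp i (c i)) := hμ _ _
    rw [zipShift_preimage_finCyl φ hF, hμF, ← prod_shiftIdx φ pp hF]
    exact hμ _ _

lemma IsProductMeasure.isProbabilityMeasure {Sm Sp : Type*} [Fintype Sp] [Nonempty Sp]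
    [DecidableEq Sm] {φ : Sp → Sm} {pp : Sp → ℝ} {μ : Measure (ZipSpace Sm Sp)}
    (hμ : IsProductMeasure φ pp μ) : IsProbabilityMeasure μ :=
  ⟨by simpa using hμ ∅ fun _ => .inr (Classical.arbitrary Sp)⟩

lemma IsProductMeasure.measurePreserving_zipShift {Sm Sp : Type*} [Fintype Sp] [Nonempty Sp]
    [DecidableEq Sm] {φ : Sp → Sm} {pp : Sp → ℝ} (hpp : ∀ s, 0 ≤ pp s)
    {μ : Measure (ZipSpace Sm Sp)} (hμ : IsProductMeasure φ pp μ) :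
    MeasurePreserving (zipShift φ) μ μ := by
  have := hμ.isProbabilityMeasure
  have hm := measurable_zipShift φ
  refine ⟨hm, (ext_of_generate_finite _ zipMS_eq_generateFrom_finCyl isPiSystem_finCyl
    ?_ ?_).symm⟩
  · rintro _ ⟨F, c, rfl⟩
    rw [Measure.map_apply hm (measurableSet_finCyl F c),
      hμ.measure_zipShift_preimage_finCyl hpp]
  · rw [Measure.map_apply hm .univ, Set.preimage_univ]

end ZipShiftPaper

/-- the quotient measure satisfies `μ̂(M̂) = μ(M)`. -/
theorem statement13 {Sm Sp : Type*} [Fintype Sm] [Fintype Sp] [Nonempty Sm] [Nonempty Sp]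
    [DecidableEq Sm]
    (φ : Sp → Sm) (hφ : Function.Surjective φ)
    (pp : Sp → ℝ) (hpp : ∀ s, 0 ≤ pp s) (hsum : ∑ s, pp s = 1)
    (μ : Measure (ZipSpace Sm Sp)) (hμ : IsProductMeasure φ pp μ) :
    ∀ M : Set (ZipSpace Sm Sp), MeasurableSet M →
      (μ.map (fibProj φ)) (hatSet φ M) = μ M := by
  intro M hM
  have hπ : Measurable (fibProj φ) := fun _ hQ => hQ
  have hσ := hμ.measurePreserving_zipShift hpp
  have hpre := fibProj_preimage_hatSet hφ M
  have hQ : MeasurableSet (hatSet φ M) := by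
    change MeasurableSet (fibProj φ ⁻¹' hatSet φ M)
    rw [hpre]
    exact hσ.measurable hM
  rw [Measure.map_apply hπ hQ, hpre, hσ.measure_preimage hM.nullMeasurableSet]
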